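/- Consider ℝ^{1+n} with the Minkowski bilinear form q(v,w) = −v₀w₀ + Σ_{i=1}^n v_i w_i, let ℓ : ℝ^{1+n} → ℝ be a linear functional, and define L₂(u) = (ℓ(u) − √(−q(u,u)))² on the open set of timelike vectors {u : q(u,u) < 0}. Let v be timelike with ℓ(v) > √(−q(v,v)). Then for every w ∈ ℝ^{1+n} with w ≠ 0, the function t ↦ L₂(v + tw) is twice differentiable at t = 0 and its second derivative at t = 0 is strictly positive; in particular the second derivative (Hessian) of L₂ at v is positive definite. -/

import Mathlib

open Filter

/-- The Minkowski bilinear form on `ℝ^{1+n}`: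
`q(v,w) = -v₀w₀ + ∑_{i=1}^n v_i w_i`. -/
def mink (n : ℕ) (v w : Fin (n + 1) → ℝ) : ℝ :=
  -(v 0 * w 0) + ∑ i : Fin n, v i.succ * w i.succ

lemma mink_orth (n : ℕ) (v u : Fin (n + 1) → ℝ) (hv : mink n v v < 0)
    (h0 : mink n v u = 0) (hu : mink n u u ≤ 0) : u = 0 := by
  unfold mink at *
  have cs := Finset.sum_mul_sq_le_sq_mul_sq Finset.univ (fun i : Fin n => v i.succ)
    (fun i : Fin n => u i.succ)
  simp only [← pow_two] at hv hu
  have hS : 0 ≤ ∑ i : Fin n, v i.succ ^ 2 := Finset.sum_nonneg fun i _ => sq_nonneg _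
  have hU : 0 ≤ ∑ i : Fin n, u i.succ ^ 2 := Finset.sum_nonneg fun i _ => sq_nonneg _
  have hP : ∑ i : Fin n, v i.succ * u i.succ = v 0 * u 0 := by linarith
  rw [hP] at cs
  set S := ∑ i : Fin n, v i.succ ^ 2
  set U := ∑ i : Fin n, u i.succ ^ 2 with hUdef
  have h1 : (v 0 ^ 2 - S) * u 0 ^ 2 ≤ 0 := by nlinarith
  have h2 : u 0 ^ 2 ≤ 0 := by
    by_contra h
    push Not at h
    have := mul_pos (show 0 < v 0 ^ 2 - S by linarith) h
    linarith
  have h3 : u 0 = 0 := by nlinarith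
  have h4 : U = 0 := by linarith
  rw [hUdef, Finset.sum_eq_zero_iff_of_nonneg (fun i _ => sq_nonneg _)] at h4
  funext i
  refine Fin.cases h3 (fun j => ?_) i
  simpa using h4 j (Finset.mem_univ j)

lemma mink_comb (n : ℕ) (v w : Fin (n + 1) → ℝ) (t : ℝ) :
    mink n (v + t • w) (v + t • w) = mink n v v + 2 * t * mink n v w + t ^ 2 * mink n w w := by
  simp only [mink, Pi.add_apply, Pi.smul_apply, smul_eq_mul, mul_add, Finset.mul_sum]
  have : ∀ i : Fin n, (v i.succ + t * w i.succ) * v i.succ + (v i.succ + t * w i.succ) * (t * w i.succ)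
    = v i.succ * v i.succ + 2 * t * (v i.succ * w i.succ) + t ^ 2 * (w i.succ * w i.succ) := by
    intro i; ring
  simp only [this, Finset.sum_add_distrib]
  ring

lemma mink_right (n : ℕ) (v w : Fin (n + 1) → ℝ) (t : ℝ) :
    mink n v (w + t • v) = mink n v w + t * mink n v v := by
  simp only [mink, Pi.add_apply, Pi.smul_apply, smul_eq_mul, mul_add, Finset.mul_sum,
    Finset.sum_add_distrib]
  have : ∀ i : Fin n, v i.succ * (t * v i.succ) = t * (v i.succ * v i.succ) := by
    intro i; ring
  simp only [this]
  ring

lemma mink_symm (n : ℕ) (v w : Fin (n + 1) → ℝ) : mink n v w = mink n w v := by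
  simp only [mink, mul_comm]

/-- For `L₂(u) = (ℓ(u) - √(-q(u,u)))²` on timelike vectors, if `v` is
timelike with `ℓ(v) > √(-q(v,v))`, then for every `w ≠ 0` the map `t ↦ L₂(v + t w)` is
twice differentiable at `0` with strictly positive second derivative; i.e. the Hessian of
`L₂` at `v` is positive definite. -/
theorem lagrangian_hessian_positive_definite
    {n : ℕ} (ℓ : (Fin (n + 1) → ℝ) →ₗ[ℝ] ℝ)
    (v : Fin (n + 1) → ℝ) (hv : mink n v v < 0)
    (hℓ : Real.sqrt (-(mink n v v)) < ℓ v) :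
    ∀ w : Fin (n + 1) → ℝ, w ≠ 0 →
      ∃ (g' : ℝ → ℝ) (E : ℝ),
        (∀ᶠ t in nhds (0 : ℝ),
          HasDerivAt
            (fun s : ℝ =>
              (ℓ (v + s • w) - Real.sqrt (-(mink n (v + s • w) (v + s • w)))) ^ 2)
            (g' t) t) ∧
        HasDerivAt g' E 0 ∧ 0 < E := by
  intro w hw
  set a := ℓ v with ha
  set b := ℓ w with hb
  obtain ⟨A, hA⟩ : ∃ A, A = -mink n v v := ⟨_, rfl⟩
  obtain ⟨B, hB⟩ : ∃ B, B = -mink n v w := ⟨_, rfl⟩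
  obtain ⟨C, hC⟩ : ∃ C, C = -mink n w w := ⟨_, rfl⟩
  have hApos : 0 < A := by linarith
  have hfun : (fun s : ℝ =>
      (ℓ (v + s • w) - Real.sqrt (-(mink n (v + s • w) (v + s • w)))) ^ 2)
      = fun s : ℝ => (a + s * b - Real.sqrt (A + 2 * s * B + s ^ 2 * C)) ^ 2 := by
    funext s
    rw [mink_comb, map_add, map_smul, smul_eq_mul, hA, hB, hC]
    congr 3
    ring
  rw [hfun]
  rw [← hA] at hℓ
  have hpoly : ∀ t : ℝ, HasDerivAt (fun s : ℝ => A + 2 * s * B + s ^ 2 * C)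
      (2 * (B + t * C)) t := by
    intro t
    have := (((hasDerivAt_id t).const_mul 2).mul_const B).const_add A |>.add
      (((hasDerivAt_id t).pow 2).mul_const C)
    refine this.congr_deriv ?_
    simp
    ring
  have hsq : ∀ t : ℝ, 0 < A + 2 * t * B + t ^ 2 * C →
      HasDerivAt (fun s : ℝ => Real.sqrt (A + 2 * s * B + s ^ 2 * C))
        ((B + t * C) / Real.sqrt (A + 2 * t * B + t ^ 2 * C)) t := by
    intro t ht
    refine ((hpoly t).sqrt ht.ne').congr_deriv ?_
    have := Real.sqrt_pos.2 ht
    field_simp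
  have hlin : ∀ (p r t : ℝ), HasDerivAt (fun s : ℝ => p + s * r) r t := by
    intro p r t
    simpa using ((hasDerivAt_id t).mul_const r).const_add p
  have hs : 0 < Real.sqrt A := Real.sqrt_pos.2 hApos
  have hss : Real.sqrt A ^ 2 = A := Real.sq_sqrt hApos.le
  refine ⟨fun t => 2 * (a + t * b - Real.sqrt (A + 2 * t * B + t ^ 2 * C)) *
    (b - (B + t * C) / Real.sqrt (A + 2 * t * B + t ^ 2 * C)),
    2 * (b - B / Real.sqrt A) ^ 2 + 2 * (a - Real.sqrt A) * ((B ^ 2 - A * C) / Real.sqrt A ^ 3),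
    ?_, ?_, ?_⟩
  · have hc : ContinuousAt (fun s : ℝ => A + 2 * s * B + s ^ 2 * C) 0 := (hpoly 0).continuousAt
    have hev := hc.eventually (lt_mem_nhds (show (0 : ℝ) < A + 2 * 0 * B + 0 ^ 2 * C by simpa))
    filter_upwards [hev] with t ht
    refine (((hlin a b t).sub (hsq t ht)).pow 2).congr_deriv ?_
    simp
  · have h0 : (0 : ℝ) < A + 2 * 0 * B + 0 ^ 2 * C := by simpa
    have d1 := hsq 0 h0
    have d2 := (((hlin a b 0).sub d1).const_mul 2).mul
      (((hlin B C 0).div d1 (Real.sqrt_pos.2 h0).ne').const_sub b)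
    refine d2.congr_deriv ?_
    have e : A + 2 * 0 * B + 0 ^ 2 * C = A := by ring
    simp only [Pi.sub_apply, Pi.div_apply, e, zero_mul, add_zero]
    rw [show (B ^ 2 - A * C) = B ^ 2 - Real.sqrt A ^ 2 * C by rw [hss]]
    field_simp
    ring
  · have hD : 0 < a - Real.sqrt A := by linarith
    rcases lt_or_ge 0 (B ^ 2 - A * C) with h | h
    · positivity
    · have hu : w + (-(B / A)) • v = 0 := by
        apply mink_orth n v _ hv
        · rw [mink_right]
          rw [show mink n v w = -B by linarith, show mink n v v = -A by linarith]
          field_simp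
          ring
        · rw [mink_comb, mink_symm n w v]
          rw [show mink n v w = -B by linarith, show mink n v v = -A by linarith,
            show mink n w w = -C by linarith]
          have : -C + 2 * -(B / A) * -B + (-(B / A)) ^ 2 * -A = (B ^ 2 - A * C) / A := by
            field_simp
            ring
          rw [this]
          exact div_nonpos_of_nonpos_of_nonneg h hApos.le
      have hwv : w = (B / A) • v := by
        rw [neg_smul] at hu
        exact add_neg_eq_zero.1 hu
      have hl : B / A ≠ 0 := by
        intro h0
        rw [h0, zero_smul] at hwv
        exact hw hwv
      have hba : b = B / A * a := by
        rw [hb, hwv, map_smul, smul_eq_mul]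
      have hBC : B ^ 2 - A * C = 0 := by
        have h1 := mink_comb n w v (-(B / A))
        rw [hu, mink_symm n w v, show mink n v w = -B by linarith,
          show mink n v v = -A by linarith, show mink n w w = -C by linarith] at h1
        simp only [mink, Pi.zero_apply, mul_zero, Finset.sum_const_zero, neg_zero, add_zero] at h1
        field_simp at h1
        linarith
      have hne : b - B / Real.sqrt A ≠ 0 := by
        have : b - B / Real.sqrt A = B / A * (a - Real.sqrt A) := by
          rw [hba, mul_sub]
          congr 1
          nth_rewrite 2 [← hss]
          field_simp
        rw [this]
        exact mul_ne_zero hl hD.ne'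
      rw [hBC]
      have := sq_pos_of_ne_zero hne
      simp
      positivity
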